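/- Weak-type characterization for the (m+1)-linear maximal operator: Let r_1,…,r_{m+1} ∈ (0,∞) and p_1,…,p_{m+1} ∈ (0,∞] satisfy 1/p_j < 1/r_j for all j and Σ_{j=1}^{m+1} 1/p_j = 1. Let w_1,…,w_{m+1} be weights with ∏_{j=1}^{m+1} w_j = 1. Then [(w_1,…,w_{m+1})]_{(p_1,…,p_{m+1}),((r_1,…,r_{m+1}),∞)} < ∞ if and only if M_{(r_1,…,r_{m+1})} is bounded from L^{p_1}(w_1^{p_1}) × ⋯ × L^{p_{m+1}}(w_{m+1}^{p_{m+1}}) to weak-L^1(ℝ^n) (with Lebesgue measure), and in this case ‖M_{(r_1,…,r_{m+1})}‖_{L^{p_1}(w_1^{p_1})×⋯×L^{p_{m+1}}(w_{m+1}^{p_{m+1}}) → L^{1,∞}} ≍ [(w_1,…,w_{m+1})]_{(p_1,…,p_{m+1}),((r_1,…,r_{m+1}),∞)}, where the implicit constants depend only on the dimension n. -/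

import Mathlib

open MeasureTheory ENNReal

noncomputable section

namespace Paper

/-- An axis-parallel (half-open) cube in `ℝⁿ` with positive side length. -/
def IsCube {n : ℕ} (Q : Set (Fin n → ℝ)) : Prop :=
  ∃ (c : Fin n → ℝ) (h : ℝ), 0 < h ∧
    Q = Set.univ.pi fun i => Set.Ico (c i) (c i + h)

/-- A weight on `ℝⁿ`: a measurable, everywhere positive function. -/
def IsWeight {n : ℕ} (w : (Fin n → ℝ) → ℝ) : Prop :=
  Measurable w ∧ ∀ x, 0 < w x

/-- `expOf ρ` is the exponent `1/ρ ∈ (0,∞]`; `ρ = 0` encodes the exponent `∞`. -/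
def expOf (ρ : ℝ) : ℝ≥0∞ := if ρ = 0 then ∞ else ENNReal.ofReal (1 / ρ)

/-- The average `⟨f⟩_{1/τ, Q}` of a real-valued `f` over `Q`;
`τ = 0` encodes the essential supremum `⟨f⟩_{∞,Q}`. -/
def avg {n : ℕ} (τ : ℝ) (f : (Fin n → ℝ) → ℝ) (Q : Set (Fin n → ℝ)) : ℝ≥0∞ :=
  if τ = 0 then essSup (fun x => ENNReal.ofReal |f x|) (volume.restrict Q)
  else ((volume Q)⁻¹ * ∫⁻ x in Q, ENNReal.ofReal |f x| ^ (1 / τ)) ^ τ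

/-- The average `⟨g⟩_{1/τ, Q}` of an `ℝ≥0∞`-valued `g` over `Q`. -/
def avgE {n : ℕ} (τ : ℝ) (g : (Fin n → ℝ) → ℝ≥0∞) (Q : Set (Fin n → ℝ)) : ℝ≥0∞ :=
  if τ = 0 then essSup g (volume.restrict Q)
  else ((volume Q)⁻¹ * ∫⁻ x in Q, g x ^ (1 / τ)) ^ τ

/-- The weighted norm `‖f‖_{L^{1/ρ}(w^{1/ρ})} = ‖f·w‖_{L^{1/ρ}(ℝⁿ)}`;
`ρ = 0` encodes `p = ∞`. -/
def wnorm {n : ℕ} (ρ : ℝ) (f w : (Fin n → ℝ) → ℝ) : ℝ≥0∞ :=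
  eLpNorm (fun x => f x * w x) (expOf ρ) volume

/-- The weighted norm `‖g·w‖_{L^{1/ρ}}` of an `ℝ≥0∞`-valued function `g`. -/
def wnormE {n : ℕ} (ρ : ℝ) (g : (Fin n → ℝ) → ℝ≥0∞) (w : (Fin n → ℝ) → ℝ) : ℝ≥0∞ :=
  if ρ = 0 then essSup (fun x => g x * ENNReal.ofReal (w x)) volume
  else (∫⁻ x, (g x * ENNReal.ofReal (w x)) ^ (1 / ρ)) ^ ρ

/-- The weak weighted norm `‖f‖_{L^{1/ρ,∞}(w^{1/ρ})}
  = sup_{t>0} t · (∫_{|f|>t} w^{1/ρ})^{ρ}`; `ρ = 0` encodes `p = ∞`. -/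
def wWeakNorm {n : ℕ} (ρ : ℝ) (f w : (Fin n → ℝ) → ℝ) : ℝ≥0∞ :=
  if ρ = 0 then wnorm 0 f w
  else ⨆ t : Set.Ioi (0 : ℝ),
    ENNReal.ofReal t.1 *
      (∫⁻ x in {x | t.1 < |f x|}, ENNReal.ofReal (w x) ^ (1 / ρ)) ^ ρ

/-- The weak weighted norm of an `ℝ≥0∞`-valued function. -/
def wWeakNormE {n : ℕ} (ρ : ℝ) (g : (Fin n → ℝ) → ℝ≥0∞) (w : (Fin n → ℝ) → ℝ) : ℝ≥0∞ :=
  if ρ = 0 then essSup (fun x => g x * ENNReal.ofReal (w x)) volume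
  else ⨆ t : Set.Ioi (0 : ℝ),
    ENNReal.ofReal t.1 *
      (∫⁻ x in {x | ENNReal.ofReal t.1 < g x}, ENNReal.ofReal (w x) ^ (1 / ρ)) ^ ρ

/-- The weak `L¹(ℝⁿ)` quasinorm (with respect to Lebesgue measure) of an
`ℝ≥0∞`-valued function. -/
def weakL1 {n : ℕ} (g : (Fin n → ℝ) → ℝ≥0∞) : ℝ≥0∞ :=
  ⨆ t : Set.Ioi (0 : ℝ), ENNReal.ofReal t.1 * volume {x | ENNReal.ofReal t.1 < g x}

/-- The limited range multilinear weight constant `[w⃗]_{p⃗,(r⃗,s)}`, written in terms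
of the reciprocal exponents `rinv j = 1/r_j`, `pinv j = 1/p_j` and `sinv = 1/s`. -/
def wConst {n m : ℕ} (rinv pinv : Fin m → ℝ) (sinv : ℝ)
    (w : Fin m → (Fin n → ℝ) → ℝ) : ℝ≥0∞ :=
  ⨆ Q : {Q : Set (Fin n → ℝ) // IsCube Q},
    (∏ j, avg (rinv j - pinv j) (fun x => (w j x)⁻¹) Q.1) *
      avg ((∑ j, pinv j) - sinv) (fun x => ∏ j, w j x) Q.1

/-- The symmetric weight constant `[w⃗]_{p⃗,(r⃗,∞)} = sup_Q ∏_j ⟨w_j⁻¹⟩_{1/(1/r_j - 1/p_j),Q}`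
for tuples of weights with `∏_j w_j = 1`. -/
def wConstS {n m : ℕ} (rinv pinv : Fin m → ℝ)
    (w : Fin m → (Fin n → ℝ) → ℝ) : ℝ≥0∞ :=
  ⨆ Q : {Q : Set (Fin n → ℝ) // IsCube Q},
    ∏ j, avg (rinv j - pinv j) (fun x => (w j x)⁻¹) Q.1

/-- The multisublinear Hardy-Littlewood maximal operator
`M_{(r_1,…,r_m)}(f⃗)(x) = sup_{Q ∋ x} ∏_j ⟨f_j⟩_{r_j,Q}` (reciprocal exponents). -/
def maximal {n m : ℕ} (rinv : Fin m → ℝ)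
    (f : Fin m → (Fin n → ℝ) → ℝ) (x : Fin n → ℝ) : ℝ≥0∞ :=
  ⨆ Q : {Q : Set (Fin n → ℝ) // IsCube Q ∧ x ∈ Q}, ∏ j, avg (rinv j) (f j) Q.1

/-- A sparse family of cubes (with sparsity constant 2): to each cube `Q` of the family
is associated a major subset `E Q ⊆ Q` with `|Q| ≤ 2|E Q|`, and these sets are
pairwise disjoint. -/
structure SparseFamily (n : ℕ) where
  cubes : Set (Set (Fin n → ℝ))
  E : Set (Fin n → ℝ) → Set (Fin n → ℝ)
  isCube : ∀ Q ∈ cubes, IsCube Q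
  E_subset : ∀ Q ∈ cubes, E Q ⊆ Q
  E_meas : ∀ Q ∈ cubes, MeasurableSet (E Q)
  E_disj : ∀ Q ∈ cubes, ∀ Q' ∈ cubes, Q ≠ Q' → Disjoint (E Q) (E Q')
  density : ∀ Q ∈ cubes, volume Q ≤ 2 * volume (E Q)

/-- The sparse form `Λ_{r⃗,S}(f⃗) = ∑_{Q∈S} (∏_j ⟨f_j⟩_{r_j,Q}) |Q|`. -/
def sparseForm {n m : ℕ} (rinv : Fin m → ℝ) (S : SparseFamily n)
    (f : Fin m → (Fin n → ℝ) → ℝ) : ℝ≥0∞ :=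
  ∑' Q : S.cubes, (∏ j, avg (rinv j) (f j) Q.1) * volume Q.1

/-- The sparse operator `A_{r⃗,S}(f⃗) = ∑_{Q∈S} (∏_j ⟨f_j⟩_{r_j,Q}) χ_Q`. -/
def sparseOp {n m : ℕ} (rinv : Fin m → ℝ) (S : SparseFamily n)
    (f : Fin m → (Fin n → ℝ) → ℝ) (x : Fin n → ℝ) : ℝ≥0∞ :=
  ∑' Q : S.cubes, (∏ j, avg (rinv j) (f j) Q.1) *
    (Q.1).indicator (fun _ => (1 : ℝ≥0∞)) x

end Paper
namespace Paper

section Cubes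

variable {n : ℕ}

lemma IsCube.measurableSet {Q : Set (Fin n → ℝ)} (hQ : IsCube Q) : MeasurableSet Q := by
  obtain ⟨c, h, -, rfl⟩ := hQ
  exact MeasurableSet.univ_pi fun _ => measurableSet_Ico

lemma IsCube.exists_closedBall {Q : Set (Fin n → ℝ)} (hQ : IsCube Q) :
    ∃ (c : Fin n → ℝ) (r : ℝ), 0 < r ∧ Q ⊆ Metric.closedBall c r ∧
      volume Q = ENNReal.ofReal (2 * r) ^ n ∧ r ≤ max 1 (volume Q).toReal := by
  obtain ⟨c, h, hh, rfl⟩ := hQ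
  have hvol : volume (Set.univ.pi fun i => Set.Ico (c i) (c i + h)) = ENNReal.ofReal h ^ n := by
    rw [Real.volume_pi_Ico]
    simp
  rcases Nat.eq_zero_or_pos n with rfl | hn
  · exact ⟨c, 1, one_pos, fun x _ => by simp [Subsingleton.elim x c], by simp [hvol],
      le_max_left _ _⟩
  · refine ⟨fun i => c i + h / 2, h / 2, by positivity, fun x hx => ?_, ?_, ?_⟩
    · rw [Metric.mem_closedBall, dist_pi_le_iff (by positivity)]
      intro i
      have := hx i (Set.mem_univ i)
      rw [Set.mem_Ico] at this
      rw [Real.dist_eq, abs_le]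
      constructor <;> linarith
    · rw [hvol]
      ring_nf
    · rw [hvol, ENNReal.toReal_pow, ENNReal.toReal_ofReal hh.le]
      rcases le_total h 1 with h1 | h1
      · exact le_max_of_le_left (by linarith)
      · exact le_max_of_le_right (by linarith [le_self_pow₀ h1 hn.ne'])

lemma IsCube.volume_ne_zero {Q : Set (Fin n → ℝ)} (hQ : IsCube Q) : volume Q ≠ 0 := by
  obtain ⟨c, r, hr, -, hv, -⟩ := hQ.exists_closedBall
  rw [hv]
  exact pow_ne_zero _ (by simpa using hr)

lemma IsCube.volume_ne_top {Q : Set (Fin n → ℝ)} (hQ : IsCube Q) : volume Q ≠ ∞ := by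
  obtain ⟨c, r, hr, -, hv, -⟩ := hQ.exists_closedBall
  rw [hv]
  exact ENNReal.pow_ne_top ENNReal.ofReal_ne_top

/-- Vitali covering: a family of cubes covers at most `4 ^ n` times the largest total volume
of its countable disjoint subfamilies. -/
lemma volume_sUnion_cubes_le (F : Set (Set (Fin n → ℝ))) (hF : ∀ Q ∈ F, IsCube Q) (K : ℝ≥0∞)
    (hK : ∀ S ⊆ F, S.Countable → S.PairwiseDisjoint id → ∑' Q : S, volume Q.1 ≤ K) :
    volume (⋃₀ F) ≤ 4 ^ n * K := by
  rcases eq_or_ne K ∞ with rfl | hKtop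
  · rw [ENNReal.mul_top (pow_ne_zero _ (by norm_num))]
    exact le_top
  have hvK : ∀ Q ∈ F, volume Q ≤ K := fun Q hQ => by
    simpa using hK {Q} (by simpa using hQ) (Set.countable_singleton Q)
      (Set.pairwiseDisjoint_singleton Q id)
  choose! c r hr hsub hvol hrle using fun Q hQ => (hF Q hQ).exists_closedBall
  obtain ⟨u, huF, hdisj, hcov⟩ := Vitali.exists_disjoint_subfamily_covering_enlargement_closedBall
    F c r (max 1 K.toReal)
    (fun Q hQ => (hrle Q hQ).trans (max_le_max le_rfl (ENNReal.toReal_mono hKtop (hvK Q hQ))))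
    4 (by norm_num)
  have hcount : u.Countable := hdisj.countable_of_nonempty_interior fun Q hQ =>
    ⟨c Q, Metric.ball_subset_interior_closedBall (Metric.mem_ball_self (hr Q (huF hQ)))⟩
  have hudisj : u.PairwiseDisjoint id := fun P hP Q hQ hne =>
    (hdisj hP hQ hne).mono (hsub P (huF hP)) (hsub Q (huF hQ))
  calc volume (⋃₀ F) ≤ volume (⋃ Q ∈ u, Metric.closedBall (c Q) (4 * r Q)) := by
        refine measure_mono (Set.sUnion_subset fun Q hQ => ?_)
        obtain ⟨P, hP, hQP⟩ := hcov Q hQ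
        exact ((hsub Q hQ).trans hQP).trans (Set.subset_biUnion_of_mem (u := fun Q =>
          Metric.closedBall (c Q) (4 * r Q)) hP)
    _ ≤ ∑' Q : u, volume (Metric.closedBall (c Q) (4 * r Q)) := measure_biUnion_le _ hcount _
    _ = ∑' Q : u, 4 ^ n * volume Q.1 := by
        refine tsum_congr fun Q => ?_
        have hrQ := hr Q (huF Q.2)
        rw [Real.volume_pi_closedBall _ (by positivity), hvol Q (huF Q.2), Fintype.card_fin,
          ENNReal.ofReal_pow (by positivity), ← mul_pow,
          show 2 * (4 * r Q) = 4 * (2 * r Q) by ring, ENNReal.ofReal_mul (by norm_num)]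
        norm_num
    _ = 4 ^ n * ∑' Q : u, volume Q.1 := ENNReal.tsum_mul_left
    _ ≤ 4 ^ n * K := by gcongr; exact hK u huF hcount hudisj

/-- Hölder's inequality for sums over a countable disjoint family of integrals. -/
lemma tsum_prod_setLIntegral_rpow_le {m : ℕ} {ρ : Fin m → ℝ} (hρ : ∀ j, 0 ≤ ρ j)
    (hsum : ∑ j, ρ j = 1) (g : Fin m → (Fin n → ℝ) → ℝ≥0∞) {S : Set (Set (Fin n → ℝ))}
    (hS : S.Countable) (hdisj : S.PairwiseDisjoint id) (hmeas : ∀ Q ∈ S, MeasurableSet Q) :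
    ∑' Q : S, ∏ j, (∫⁻ x in Q.1, g j x) ^ ρ j ≤ ∏ j, (∫⁻ x, g j x) ^ ρ j := by
  have : Countable S := hS.to_subtype
  let _ : MeasurableSpace S := ⊤
  have hH := ENNReal.lintegral_prod_norm_pow_le (μ := (Measure.count : Measure S)) Finset.univ
    (f := fun j (Q : S) => ∫⁻ x in Q.1, g j x) (fun j _ => (measurable_from_top).aemeasurable)
    hsum (fun j _ => hρ j)
  simp only [lintegral_count] at hH
  refine hH.trans (Finset.prod_le_prod' fun j _ => ENNReal.rpow_le_rpow ?_ (hρ j))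
  rw [← lintegral_iUnion (fun Q : S => hmeas Q Q.2)
    (fun P Q hPQ => hdisj P.2 Q.2 (Subtype.coe_injective.ne hPQ))]
  exact setLIntegral_le_lintegral _ _

end Cubes

section Averages

variable {n : ℕ}

lemma avg_of_ne_zero {τ : ℝ} (hτ : τ ≠ 0) (f : (Fin n → ℝ) → ℝ) (Q : Set (Fin n → ℝ)) :
    avg τ f Q = ((volume Q)⁻¹ * ∫⁻ x in Q, ENNReal.ofReal |f x| ^ (1 / τ)) ^ τ := if_neg hτ

lemma prod_rpow_eq_of_sum_eq_one {ι : Type*} [Fintype ι] {ρ : ι → ℝ} (hρ : ∀ i, 0 ≤ ρ i)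
    (hsum : ∑ i, ρ i = 1) (a : ℝ≥0∞) : ∏ i, a ^ ρ i = a := by
  classical
  have h : ∀ s : Finset ι, ∏ i ∈ s, a ^ ρ i = a ^ ∑ i ∈ s, ρ i := fun s => by
    induction s using Finset.induction with
    | empty => simp
    | insert i s hi ih =>
      rw [Finset.prod_insert hi, Finset.sum_insert hi, ih,
        ENNReal.rpow_add_of_nonneg _ _ (hρ i) (Finset.sum_nonneg fun j _ => hρ j)]
  rw [h, hsum, ENNReal.rpow_one]

lemma ofReal_abs_eq_inv_mul {a w : ℝ} (hw : 0 < w) :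
    ENNReal.ofReal |a| = ENNReal.ofReal |w⁻¹| * ‖a * w‖ₑ := by
  rw [← ofReal_norm, ← ENNReal.ofReal_mul (abs_nonneg _), Real.norm_eq_abs, ← abs_mul]
  congr 2
  field_simp

/-- Hölder's inequality on cubes, with the weighted norm split as `(∫ g) ^ ρ * D`
uniformly in `0 ≤ ρ < 1 / r`. -/
lemma exists_avg_le {σ ρ : ℝ} (hρ : 0 ≤ ρ) (hσ : ρ < σ) {f w : (Fin n → ℝ) → ℝ}
    (hf : Measurable f) (hw : IsWeight w) :
    ∃ (g : (Fin n → ℝ) → ℝ≥0∞) (D : ℝ≥0∞), wnorm ρ f w = (∫⁻ x, g x) ^ ρ * D ∧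
      ∀ Q, avg σ f Q ≤
        avg (σ - ρ) (fun x => (w x)⁻¹) Q * (((volume Q)⁻¹ * ∫⁻ x in Q, g x) ^ ρ * D) := by
  have hσ0 : 0 < σ := hρ.trans_lt hσ
  have hτ : 0 < σ - ρ := sub_pos.2 hσ
  have hfac : ∀ x, ENNReal.ofReal |f x| = ENNReal.ofReal |(w x)⁻¹| * ‖f x * w x‖ₑ := fun x =>
    ofReal_abs_eq_inv_mul (hw.2 x)
  rcases hρ.eq_or_lt with rfl | hρ
  · refine ⟨0, wnorm 0 f w, by simp, fun Q => ?_⟩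
    simp only [sub_zero, ENNReal.rpow_zero, one_mul]
    rw [avg_of_ne_zero hσ0.ne', avg_of_ne_zero hσ0.ne']
    have hle : ∀ᵐ x ∂(volume.restrict Q), ENNReal.ofReal |f x| ^ (1 / σ) ≤
        ENNReal.ofReal |(w x)⁻¹| ^ (1 / σ) * wnorm 0 f w ^ (1 / σ) := by
      refine ae_restrict_of_ae ?_
      have : wnorm 0 f w = eLpNormEssSup (fun x => f x * w x) volume := by
        simp [wnorm, expOf]
      rw [this]
      filter_upwards [ae_le_eLpNormEssSup (f := fun x => f x * w x)] with x hx
      rw [hfac, ENNReal.mul_rpow_of_nonneg _ _ (by positivity)]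
      gcongr
    calc _ ≤ ((volume Q)⁻¹ * ∫⁻ x in Q, ENNReal.ofReal |(w x)⁻¹| ^ (1 / σ) *
          wnorm 0 f w ^ (1 / σ)) ^ σ := by
          exact ENNReal.rpow_le_rpow (mul_le_mul_right (lintegral_mono_ae hle) _) hσ0.le
      _ = _ := by
          have hm : Measurable fun x => ENNReal.ofReal |(w x)⁻¹| ^ (1 / σ) :=
            (hw.1.inv.abs.ennreal_ofReal).pow_const _
          rw [lintegral_mul_const _ hm, ← mul_assoc, ENNReal.mul_rpow_of_nonneg _ _ hσ0.le,
            ← ENNReal.rpow_mul, one_div_mul_cancel hσ0.ne', ENNReal.rpow_one]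
  · refine ⟨fun x => ‖f x * w x‖ₑ ^ (1 / ρ), 1, ?_, fun Q => ?_⟩
    · have h0 : ENNReal.ofReal (1 / ρ) ≠ 0 := by simpa using hρ
      rw [wnorm, expOf, if_neg hρ.ne',
        eLpNorm_eq_lintegral_rpow_enorm_toReal h0 ENNReal.ofReal_ne_top,
        ENNReal.toReal_ofReal (by positivity), one_div_one_div, mul_one]
    · rw [avg_of_ne_zero hσ0.ne', avg_of_ne_zero hτ.ne', mul_one]
      have hH := ENNReal.lintegral_Lp_mul_le_Lq_mul_Lr (p := 1 / σ) (q := 1 / (σ - ρ))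
        (r := 1 / ρ) (by positivity) (one_div_lt_one_div_of_lt hτ (by linarith))
        (by simp) (volume.restrict Q)
        (f := fun x => ENNReal.ofReal |(w x)⁻¹|) (g := fun x => ‖f x * w x‖ₑ)
        hw.1.inv.abs.ennreal_ofReal.aemeasurable (hf.mul hw.1).enorm.aemeasurable
      simp only [Pi.mul_apply, ← hfac, one_div_one_div] at hH
      rw [ENNReal.mul_rpow_of_nonneg _ _ hσ0.le, ENNReal.mul_rpow_of_nonneg _ _ hτ.le,
        ENNReal.mul_rpow_of_nonneg _ _ hρ.le, mul_mul_mul_comm,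
        ← ENNReal.rpow_add_of_nonneg _ _ hτ.le hρ.le, sub_add_cancel]
      gcongr

/-- The weak-type bound for the maximal operator by the weight constant. -/
lemma weakL1_maximal_le {m : ℕ} {rinv pinv : Fin (m + 1) → ℝ} (hp : ∀ j, 0 ≤ pinv j)
    (hpr : ∀ j, pinv j < rinv j) (hsum : ∑ j, pinv j = 1)
    {w : Fin (m + 1) → (Fin n → ℝ) → ℝ} (hw : ∀ j, IsWeight (w j))
    {f : Fin (m + 1) → (Fin n → ℝ) → ℝ} (hf : ∀ j, Measurable (f j)) :
    weakL1 (maximal rinv f) ≤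
      4 ^ n * wConstS rinv pinv w * ∏ j, wnorm (pinv j) (f j) (w j) := by
  choose g D hD havg using fun j => exists_avg_le (hp j) (hpr j) (hf j) (hw j)
  refine iSup_le fun ⟨t, ht⟩ => ?_
  have ht0 : ENNReal.ofReal t ≠ 0 := by simpa using ht
  set W := wConstS rinv pinv w
  set N := ∏ j, wnorm (pinv j) (f j) (w j)
  set F : Set (Set (Fin n → ℝ)) := {Q | IsCube Q ∧ ENNReal.ofReal t < ∏ j, avg (rinv j) (f j) Q}
  have hcover : {x | ENNReal.ofReal t < maximal rinv f x} ⊆ ⋃₀ F := fun x hx => by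
    obtain ⟨Q, hQ⟩ := lt_iSup_iff.1 (show ENNReal.ofReal t < maximal rinv f x from hx)
    exact ⟨Q.1, ⟨Q.2.1, hQ⟩, Q.2.2⟩
  have hcube : ∀ Q ∈ F, ENNReal.ofReal t * volume Q ≤
      W * (∏ j, D j) * ∏ j, (∫⁻ x in Q, g j x) ^ pinv j := fun Q hQ => by
    have hWQ : ∏ j, avg (rinv j - pinv j) (fun x => (w j x)⁻¹) Q ≤ W :=
      le_iSup (fun Q : {Q : Set (Fin n → ℝ) // IsCube Q} =>
        ∏ j, avg (rinv j - pinv j) (fun x => (w j x)⁻¹) Q.1) ⟨Q, hQ.1⟩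
    have hvol : ∏ j, ((volume Q)⁻¹) ^ pinv j = (volume Q)⁻¹ :=
      prod_rpow_eq_of_sum_eq_one hp hsum _
    calc ENNReal.ofReal t * volume Q
        ≤ (∏ j, avg (rinv j) (f j) Q) * volume Q := by gcongr; exact hQ.2.le
      _ ≤ (∏ j, (avg (rinv j - pinv j) (fun x => (w j x)⁻¹) Q *
            (((volume Q)⁻¹ * ∫⁻ x in Q, g j x) ^ pinv j * D j))) * volume Q := by
          gcongr with j; exact havg j Q
      _ = (∏ j, avg (rinv j - pinv j) (fun x => (w j x)⁻¹) Q) * (∏ j, D j) *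
            (∏ j, (∫⁻ x in Q, g j x) ^ pinv j) * ((volume Q)⁻¹ * volume Q) := by
          simp only [ENNReal.mul_rpow_of_nonneg _ _ (hp _), Finset.prod_mul_distrib, hvol]
          ring
      _ ≤ W * (∏ j, D j) * ∏ j, (∫⁻ x in Q, g j x) ^ pinv j := by
          rw [ENNReal.inv_mul_cancel hQ.1.volume_ne_zero hQ.1.volume_ne_top, mul_one]
          gcongr
  have hbound : ∀ S ⊆ F, S.Countable → S.PairwiseDisjoint id →
      ∑' Q : S, volume Q.1 ≤ W * N / ENNReal.ofReal t := fun S hSF hS hdisj => by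
    rw [ENNReal.le_div_iff_mul_le (Or.inl ht0) (Or.inl ENNReal.ofReal_ne_top), mul_comm,
      ← ENNReal.tsum_mul_left]
    calc ∑' Q : S, ENNReal.ofReal t * volume Q.1
        ≤ ∑' Q : S, W * (∏ j, D j) * ∏ j, (∫⁻ x in Q.1, g j x) ^ pinv j :=
          ENNReal.tsum_le_tsum fun Q => hcube Q (hSF Q.2)
      _ ≤ W * (∏ j, D j) * ∏ j, (∫⁻ x, g j x) ^ pinv j := by
          rw [ENNReal.tsum_mul_left]
          gcongr
          exact tsum_prod_setLIntegral_rpow_le hp hsum g hS hdisj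
            fun Q hQ => (hSF hQ).1.measurableSet
      _ = W * N := by
          simp only [N, hD, Finset.prod_mul_distrib]
          ring
  calc ENNReal.ofReal t * volume {x | ENNReal.ofReal t < maximal rinv f x}
      ≤ ENNReal.ofReal t * (4 ^ n * (W * N / ENNReal.ofReal t)) := by
        gcongr
        exact (measure_mono hcover).trans (volume_sUnion_cubes_le F (fun Q hQ => hQ.1) _ hbound)
    _ = 4 ^ n * W * N := by
        rw [mul_left_comm, ENNReal.mul_div_cancel ht0 ENNReal.ofReal_ne_top, mul_assoc]

/-- The maximal function is at least the product of the averages on each cube. -/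
lemma prod_avg_mul_volume_le_weakL1 {m : ℕ} (rinv : Fin m → ℝ) (f : Fin m → (Fin n → ℝ) → ℝ)
    {Q : Set (Fin n → ℝ)} (hQ : IsCube Q) :
    (∏ j, avg (rinv j) (f j) Q) * volume Q ≤ weakL1 (maximal rinv f) := by
  rw [← ENNReal.le_div_iff_mul_le (Or.inl hQ.volume_ne_zero) (Or.inl hQ.volume_ne_top)]
  refine le_of_forall_lt fun a ha => ?_
  obtain ⟨b, hab, hb⟩ := exists_between ha
  have hbtop : b ≠ ∞ := hb.ne_top
  have hb0 : b ≠ 0 := (bot_lt_of_lt hab).ne'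
  refine hab.trans_le ?_
  rw [ENNReal.le_div_iff_mul_le (Or.inl hQ.volume_ne_zero) (Or.inl hQ.volume_ne_top)]
  refine le_trans ?_ (le_iSup _ ⟨b.toReal, ENNReal.toReal_pos hb0 hbtop⟩)
  simp only [ENNReal.ofReal_toReal hbtop]
  gcongr
  intro x hx
  exact hb.trans_le (le_iSup (fun P : {P : Set (Fin n → ℝ) // IsCube P ∧ x ∈ P} =>
    ∏ j, avg (rinv j) (f j) P.1) ⟨Q, hQ, hx⟩)

lemma avg_ne_zero {τ : ℝ} (hτ : 0 < τ) {v : (Fin n → ℝ) → ℝ} (hv : IsWeight v)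
    {Q : Set (Fin n → ℝ)} (hQ : IsCube Q) : avg τ v Q ≠ 0 := by
  rw [avg_of_ne_zero hτ.ne']
  have h : 0 < ∫⁻ x in Q, ENNReal.ofReal |v x| ^ (1 / τ) := by
    rw [setLIntegral_pos_iff (hv.1.abs.ennreal_ofReal.pow_const _)]
    have : (Function.support fun x => ENNReal.ofReal |v x| ^ (1 / τ)) = Set.univ := by
      refine Set.eq_univ_of_forall fun x => ?_
      have : 0 < ENNReal.ofReal |v x| := by simpa using (hv.2 x).ne'
      exact (ENNReal.rpow_pos this ENNReal.ofReal_ne_top).ne'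
    rw [this, Set.univ_inter]
    exact pos_iff_ne_zero.2 hQ.volume_ne_zero
  have h' : 0 < (volume Q)⁻¹ * ∫⁻ x in Q, ENNReal.ofReal |v x| ^ (1 / τ) :=
    ENNReal.mul_pos (ENNReal.inv_ne_zero.2 hQ.volume_ne_top) h.ne'
  intro h0
  rcases (ENNReal.rpow_eq_zero_iff.1 h0) with ⟨h1, -⟩ | ⟨-, h1⟩
  · exact h'.ne' h1
  · linarith

lemma avg_ne_top_of_le {τ N : ℝ} (hτ : 0 < τ) {v : (Fin n → ℝ) → ℝ} (hN : ∀ x, |v x| ≤ N)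
    {Q : Set (Fin n → ℝ)} (hQ : IsCube Q) : avg τ v Q ≠ ∞ := by
  rw [avg_of_ne_zero hτ.ne']
  refine ENNReal.rpow_ne_top_of_nonneg hτ.le (ENNReal.mul_ne_top
    (ENNReal.inv_ne_top.2 hQ.volume_ne_zero) (ne_top_of_le_ne_top ?_
      (setLIntegral_mono measurable_const fun x _ =>
        ENNReal.rpow_le_rpow (ENNReal.ofReal_le_ofReal (hN x)) (by positivity : 0 ≤ 1 / τ))))
  rw [setLIntegral_const]
  exact ENNReal.mul_ne_top (ENNReal.rpow_ne_top_of_nonneg (by positivity) ENNReal.ofReal_ne_top)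
    hQ.volume_ne_top

lemma tendsto_avg_min {τ : ℝ} (hτ : 0 < τ) {v : (Fin n → ℝ) → ℝ} (hv : IsWeight v)
    {Q : Set (Fin n → ℝ)} (hQ : IsCube Q) :
    Filter.Tendsto (fun N : ℕ => avg τ (fun x => min (v x) (N + 1)) Q) Filter.atTop
      (nhds (avg τ v Q)) := by
  simp only [avg_of_ne_zero hτ.ne']
  refine (ENNReal.continuous_rpow_const.tendsto _).comp (ENNReal.Tendsto.const_mul ?_
    (Or.inr (ENNReal.inv_ne_top.2 hQ.volume_ne_zero)))
  have habs : ∀ (N : ℕ) x, |min (v x) ((N : ℝ) + 1)| = min (v x) (N + 1) := fun N x =>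
    abs_of_pos (lt_min (hv.2 x) (by positivity))
  refine lintegral_tendsto_of_tendsto_of_monotone
    (fun N => ((hv.1.min measurable_const).abs.ennreal_ofReal.pow_const _).aemeasurable)
    (ae_of_all _ fun x M N hMN => ?_) (ae_of_all _ fun x => ?_)
  · simp only [habs]
    gcongr
  · refine tendsto_const_nhds.congr' ?_
    filter_upwards [Filter.eventually_ge_atTop ⌈v x⌉₊] with N hN
    have : v x ≤ N + 1 := (Nat.le_ceil _).trans (by
      have : ((⌈v x⌉₊ : ℕ) : ℝ) ≤ N := by exact_mod_cast hN
      linarith)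
    rw [min_eq_left this]

lemma tendsto_finset_prod_of_ne_zero {ι : Type*} (s : Finset ι) {a : ι → ℕ → ℝ≥0∞}
    {b : ι → ℝ≥0∞} (hab : ∀ i ∈ s, Filter.Tendsto (a i) Filter.atTop (nhds (b i)))
    (hb : ∀ i ∈ s, b i ≠ 0) :
    Filter.Tendsto (fun N => ∏ i ∈ s, a i N) Filter.atTop (nhds (∏ i ∈ s, b i)) := by
  classical
  induction s using Finset.induction with
  | empty => simp
  | insert i s hi ih =>
    simp only [Finset.prod_insert hi]
    exact ENNReal.Tendsto.mul (hab i (by simp)) (Or.inl (hb i (by simp)))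
      (ih (fun j hj => hab j (by simp [hj])) (fun j hj => hb j (by simp [hj])))
      (Or.inl (Finset.prod_ne_zero_iff.2 fun j hj => hb j (by simp [hj])))

/-- The extremal function `u ^ (s / r) χ_Q`, where `σ = 1 / r`, `τ = 1 / s`. -/
def testFun (σ τ : ℝ) (u : (Fin n → ℝ) → ℝ) (Q : Set (Fin n → ℝ)) : (Fin n → ℝ) → ℝ :=
  Q.indicator fun x => u x ^ (σ / τ)

lemma avg_testFun {σ τ : ℝ} (hσ : 0 < σ) (hτ : 0 < τ) {u : (Fin n → ℝ) → ℝ} (hu : IsWeight u)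
    {Q : Set (Fin n → ℝ)} (hQ : IsCube Q) :
    avg σ (testFun σ τ u Q) Q = avg τ u Q ^ (σ / τ) := by
  rw [avg_of_ne_zero hσ.ne', avg_of_ne_zero hτ.ne', ← ENNReal.rpow_mul,
    mul_div_cancel₀ _ hτ.ne']
  congr 2
  refine setLIntegral_congr_fun hQ.measurableSet fun x hx => ?_
  have hux := hu.2 x
  simp only [testFun, Set.indicator_of_mem hx]
  rw [abs_of_pos hux, abs_of_pos (Real.rpow_pos_of_pos hux _),
    ← ENNReal.ofReal_rpow_of_pos hux, ← ENNReal.rpow_mul]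
  congr 1
  field_simp

lemma wnorm_testFun_le {σ ρ : ℝ} (hρ : 0 ≤ ρ) (hσ : ρ < σ) {u w : (Fin n → ℝ) → ℝ}
    (hu : IsWeight u) (hw : IsWeight w) (huw : ∀ x, u x ≤ (w x)⁻¹)
    {Q : Set (Fin n → ℝ)} (hQ : IsCube Q) :
    wnorm ρ (testFun σ (σ - ρ) u Q) w ≤
      volume Q ^ ρ * avg (σ - ρ) u Q ^ (ρ / (σ - ρ)) := by
  have hτ : 0 < σ - ρ := sub_pos.2 hσ
  have hpt : ∀ x, ‖testFun σ (σ - ρ) u Q x * w x‖ₑ ≤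
      Q.indicator (fun x => ENNReal.ofReal |u x| ^ (ρ / (σ - ρ))) x := fun x => by
    by_cases hx : x ∈ Q
    · have hux := hu.2 x
      simp only [testFun, Set.indicator_of_mem hx]
      rw [abs_of_pos hux, ENNReal.ofReal_rpow_of_pos hux, ← ofReal_norm,
        Real.norm_of_nonneg (by have := hw.2 x; positivity)]
      refine ENNReal.ofReal_le_ofReal ?_
      have hexp : σ / (σ - ρ) = ρ / (σ - ρ) + 1 := by field_simp; ring
      have huw' : u x * w x ≤ 1 := by
        have := mul_le_mul_of_nonneg_right (huw x) (hw.2 x).le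
        rwa [inv_mul_cancel₀ (hw.2 x).ne'] at this
      rw [hexp, Real.rpow_add_one hux.ne', mul_assoc]
      exact mul_le_of_le_one_right (by positivity) huw'
    · simp [testFun, Set.indicator_of_notMem hx]
  rcases hρ.eq_or_lt with rfl | hρ
  · have hle : wnorm 0 (testFun σ (σ - 0) u Q) w ≤ 1 := by
      have : wnorm 0 (testFun σ (σ - 0) u Q) w =
          eLpNormEssSup (fun x => testFun σ (σ - 0) u Q x * w x) volume := by
        simp [wnorm, expOf]
      rw [this]
      refine essSup_le_of_ae_le _ (ae_of_all _ fun x => (hpt x).trans ?_)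
      simp only [zero_div, ENNReal.rpow_zero]
      exact Set.indicator_le_self _ _ x
    simpa using hle
  · have h0 : ENNReal.ofReal (1 / ρ) ≠ 0 := by simpa using hρ
    rw [wnorm, expOf, if_neg hρ.ne',
      eLpNorm_eq_lintegral_rpow_enorm_toReal h0 ENNReal.ofReal_ne_top,
      ENNReal.toReal_ofReal (by positivity), one_div_one_div, avg_of_ne_zero hτ.ne',
      ← ENNReal.rpow_mul, mul_div_cancel₀ _ hτ.ne', ← ENNReal.mul_rpow_of_nonneg _ _ hρ.le,
      ← mul_assoc, ENNReal.mul_inv_cancel hQ.volume_ne_zero hQ.volume_ne_top, one_mul,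
      ← lintegral_indicator hQ.measurableSet]
    refine ENNReal.rpow_le_rpow (lintegral_mono fun x => ?_) hρ.le
    refine (ENNReal.rpow_le_rpow (hpt x) (by positivity)).trans ?_
    by_cases hx : x ∈ Q
    · simp only [Set.indicator_of_mem hx]
      rw [← ENNReal.rpow_mul]
      refine le_of_eq ?_
      congr 1
      field_simp
    · simp [Set.indicator_of_notMem hx, hρ]

/-- The lower bound for the operator norm, tested on a bounded minorant of the dual weights. -/
lemma prod_avg_le_of_weakL1_le {m : ℕ} {rinv pinv : Fin (m + 1) → ℝ} (hp : ∀ j, 0 ≤ pinv j)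
    (hpr : ∀ j, pinv j < rinv j) (hsum : ∑ j, pinv j = 1)
    {w u : Fin (m + 1) → (Fin n → ℝ) → ℝ} (hw : ∀ j, IsWeight (w j)) (hu : ∀ j, IsWeight (u j))
    (huw : ∀ j x, u j x ≤ (w j x)⁻¹) {N : ℝ} (huN : ∀ j x, u j x ≤ N) {B : ℝ≥0∞}
    (hB : ∀ f : Fin (m + 1) → (Fin n → ℝ) → ℝ, (∀ j, Measurable (f j)) →
      weakL1 (maximal rinv f) ≤ B * ∏ j, wnorm (pinv j) (f j) (w j))
    {Q : Set (Fin n → ℝ)} (hQ : IsCube Q) :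
    ∏ j, avg (rinv j - pinv j) (u j) Q ≤ B := by
  have hτ : ∀ j, 0 < rinv j - pinv j := fun j => sub_pos.2 (hpr j)
  have hr : ∀ j, 0 < rinv j := fun j => (hp j).trans_lt (hpr j)
  have hne0 : ∀ j, avg (rinv j - pinv j) (u j) Q ≠ 0 := fun j => avg_ne_zero (hτ j) (hu j) hQ
  have hnet : ∀ j, avg (rinv j - pinv j) (u j) Q ≠ ∞ := fun j =>
    avg_ne_top_of_le (hτ j) (fun x => (abs_of_pos ((hu j).2 x)).trans_le (huN j x)) hQ
  set A := fun j => avg (rinv j - pinv j) (u j) Q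
  set P := ∏ j, A j ^ (pinv j / (rinv j - pinv j))
  have hP0 : P ≠ 0 := Finset.prod_ne_zero_iff.2 fun j _ =>
    (ENNReal.rpow_pos (pos_iff_ne_zero.2 (hne0 j)) (hnet j)).ne'
  have hPt : P ≠ ∞ := ENNReal.prod_ne_top fun j _ =>
    ENNReal.rpow_ne_top_of_nonneg (div_nonneg (hp j) (hτ j).le) (hnet j)
  have hvol : ∏ j, volume Q ^ pinv j = volume Q :=
    prod_rpow_eq_of_sum_eq_one hp hsum _
  have key : (∏ j, A j) * (P * volume Q) ≤ B * (P * volume Q) := by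
    calc (∏ j, A j) * (P * volume Q)
        = (∏ j, avg (rinv j) (testFun (rinv j) (rinv j - pinv j) (u j) Q) Q) * volume Q := by
          rw [← mul_assoc, ← Finset.prod_mul_distrib]
          congr 1
          refine Finset.prod_congr rfl fun j _ => ?_
          have hexp : rinv j / (rinv j - pinv j) = 1 + pinv j / (rinv j - pinv j) := by
            have := (hτ j).ne'
            field_simp
            ring
          rw [avg_testFun (hr j) (hτ j) (hu j) hQ, hexp,
            ENNReal.rpow_add _ _ (hne0 j) (hnet j), ENNReal.rpow_one]
      _ ≤ _ := prod_avg_mul_volume_le_weakL1 _ _ hQ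
      _ ≤ _ := hB _ fun j => ((hu j).1.pow_const _).indicator hQ.measurableSet
      _ ≤ B * ∏ j, (volume Q ^ pinv j * A j ^ (pinv j / (rinv j - pinv j))) := by
          gcongr with j
          exact wnorm_testFun_le (hp j) (hpr j) (hu j) (hw j) (huw j) hQ
      _ = B * (P * volume Q) := by
          rw [Finset.prod_mul_distrib, hvol, mul_comm P]
  exact (ENNReal.mul_le_mul_iff_left (mul_ne_zero hP0 hQ.volume_ne_zero)
    (ENNReal.mul_ne_top hPt hQ.volume_ne_top)).1 key

/-- The weight constant is at most any weak-type bound of the maximal operator. -/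
lemma wConstS_le_of_weakL1_le {m : ℕ} {rinv pinv : Fin (m + 1) → ℝ} (hp : ∀ j, 0 ≤ pinv j)
    (hpr : ∀ j, pinv j < rinv j) (hsum : ∑ j, pinv j = 1)
    {w : Fin (m + 1) → (Fin n → ℝ) → ℝ} (hw : ∀ j, IsWeight (w j)) {B : ℝ≥0∞}
    (hB : ∀ f : Fin (m + 1) → (Fin n → ℝ) → ℝ, (∀ j, Measurable (f j)) →
      weakL1 (maximal rinv f) ≤ B * ∏ j, wnorm (pinv j) (f j) (w j)) :
    wConstS rinv pinv w ≤ B := by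
  refine iSup_le fun ⟨Q, hQ⟩ => ?_
  have hτ : ∀ j, 0 < rinv j - pinv j := fun j => sub_pos.2 (hpr j)
  have hv : ∀ j, IsWeight fun x => (w j x)⁻¹ := fun j =>
    ⟨(hw j).1.inv, fun x => inv_pos.2 ((hw j).2 x)⟩
  refine le_of_tendsto' (tendsto_finset_prod_of_ne_zero Finset.univ
    (fun j _ => tendsto_avg_min (hτ j) (hv j) hQ) fun j _ => avg_ne_zero (hτ j) (hv j) hQ) fun N => ?_
  exact prod_avg_le_of_weakL1_le hp hpr hsum hw
    (fun j => ⟨(hv j).1.min measurable_const, fun x => lt_min ((hv j).2 x) (by positivity)⟩)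
    (fun j x => min_le_left _ _) (fun j x => min_le_right _ _) hB hQ

end Averages

/-- **Weak-type characterization for the `(m+1)`-linear maximal operator**
(part of Proposition 2.5): with `∏_j w_j = 1`, `∑_j 1/p_j = 1` and `1/p_j < 1/r_j`,
the weight constant `[w⃗]` is finite iff `M_{r⃗}` maps
`L^{p_1}(w_1^{p_1}) × ⋯ × L^{p_{m+1}}(w_{m+1}^{p_{m+1}})` to weak-`L¹`, with
`‖M_{r⃗}‖ ≍ [w⃗]` up to dimensional constants. -/
theorem maximal_weakL1_characterization (n : ℕ) :
    ∃ C : ℝ≥0∞, 0 < C ∧ C < ∞ ∧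
      ∀ (m : ℕ) (rinv pinv : Fin (m + 1) → ℝ),
        (∀ j, 0 < rinv j) → (∀ j, 0 ≤ pinv j) → (∀ j, pinv j < rinv j) →
        (∑ j, pinv j) = 1 →
        ∀ w : Fin (m + 1) → (Fin n → ℝ) → ℝ, (∀ j, IsWeight (w j)) →
          (∀ x, ∏ j, w j x = 1) →
        (∀ f : Fin (m + 1) → (Fin n → ℝ) → ℝ, (∀ j, Measurable (f j)) →
            weakL1 (maximal rinv f) ≤
              C * wConstS rinv pinv w * ∏ j, wnorm (pinv j) (f j) (w j)) ∧
        (∀ B : ℝ≥0∞,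
            (∀ f : Fin (m + 1) → (Fin n → ℝ) → ℝ, (∀ j, Measurable (f j)) →
              weakL1 (maximal rinv f) ≤ B * ∏ j, wnorm (pinv j) (f j) (w j)) →
            wConstS rinv pinv w ≤ C * B) ∧
        (wConstS rinv pinv w < ∞ ↔
          ∃ B : ℝ≥0∞, B < ∞ ∧
            ∀ f : Fin (m + 1) → (Fin n → ℝ) → ℝ, (∀ j, Measurable (f j)) →
              weakL1 (maximal rinv f) ≤ B * ∏ j, wnorm (pinv j) (f j) (w j)) := by
  have hC : (4 : ℝ≥0∞) ^ n < ∞ := ENNReal.pow_lt_top (by norm_num)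
  refine ⟨4 ^ n, pos_iff_ne_zero.2 (pow_ne_zero _ (by norm_num)), hC,
    fun m rinv pinv _ hp hpr hsum w hw _ => ?_⟩
  refine ⟨fun f hf => weakL1_maximal_le hp hpr hsum hw hf, fun B hB => ?_,
    fun hW => ⟨_, ENNReal.mul_lt_top hC hW, fun f hf => weakL1_maximal_le hp hpr hsum hw hf⟩,
    fun ⟨B, hBtop, hB⟩ => (wConstS_le_of_weakL1_le hp hpr hsum hw hB).trans_lt hBtop⟩
  exact (wConstS_le_of_weakL1_le hp hpr hsum hw hB).trans
    (le_mul_of_one_le_left' (one_le_pow₀ (by norm_num)))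

end Paper
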